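/- Let n ≥ 2 and let G and h_1,…,h_n be twice differentiable strictly monotone real functions with G' > 0, and set f(x) = G(h_1(x_1)+…+h_n(x_n)) on ℝ_{>0}^n. If f satisfies the proportional marginal rate of substitution property, then x_i·h_i'(x_i) = x_j·h_j'(x_j) for all i ≠ j and all x ∈ ℝ_{>0}^n; consequently there is a single nonzero constant k with t·h_i'(t) = k for all t > 0 and all i = 1,…,n. -/

import Mathlib

/-- Partial derivative of `f : ℝⁿ → ℝ` with respect to the `i`-th coordinate at `x`. -/
noncomputable def pd {n : ℕ} (f : (Fin n → ℝ) → ℝ) (i : Fin n) (x : Fin n → ℝ) : ℝ :=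
  deriv (fun t => f (Function.update x i t)) (x i)

/-- Chain rule for the partial derivatives of a quasi-sum on the positive orthant. -/
theorem pd_quasiSum {n : ℕ} {G : ℝ → ℝ} {h : Fin n → ℝ → ℝ} {f : (Fin n → ℝ) → ℝ}
    (hf : ∀ x : Fin n → ℝ, (∀ j, 0 < x j) → f x = G (∑ j, h j (x j)))
    {x : Fin n → ℝ} (hx : ∀ j, 0 < x j) (i : Fin n)
    (hG : DifferentiableAt ℝ G (∑ j, h j (x j))) (hh : DifferentiableAt ℝ (h i) (x i)) :
    pd f i x = deriv G (∑ j, h j (x j)) * deriv (h i) (x i) := by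
  have hsplit : ∑ j, h j (x j) = h i (x i) + ∑ j ∈ Finset.univ.erase i, h j (x j) :=
    (Finset.add_sum_erase _ _ (Finset.mem_univ i)).symm
  have hev : (fun t => f (Function.update x i t)) =ᶠ[nhds (x i)]
      fun t => G (h i t + ∑ j ∈ Finset.univ.erase i, h j (x j)) := by
    filter_upwards [Ioi_mem_nhds (hx i)] with t ht
    have hpos : ∀ j, 0 < Function.update x i t j := by
      intro j
      by_cases hj : j = i
      · subst hj
        simpa using ht
      · simpa [hj] using hx j
    rw [hf _ hpos, ← Finset.add_sum_erase _ _ (Finset.mem_univ i), Function.update_self]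
    congr 2
    refine Finset.sum_congr rfl fun j hj => ?_
    rw [Function.update_of_ne (Finset.ne_of_mem_erase hj)]
  rw [hsplit] at hG ⊢
  unfold pd
  rw [hev.deriv_eq]
  exact (hG.hasDerivAt.comp (x i) (hh.hasDerivAt.add_const _)).deriv

/-- If a quasi-sum production function satisfies the proportional marginal rate of
substitution property, then `xᵢ·hᵢ'(xᵢ) = xⱼ·hⱼ'(xⱼ)` for all `i ≠ j`, and consequently
there is a single nonzero constant `k` with `t·hᵢ'(t) = k` for all `t > 0` and all `i`. -/
theorem quasiSum_proportionalMRS_thprime_const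
    (n : ℕ) (hn : 2 ≤ n)
    (G : ℝ → ℝ) (h : Fin n → ℝ → ℝ) (f : (Fin n → ℝ) → ℝ)
    (hf : ∀ x : Fin n → ℝ, (∀ j, 0 < x j) → f x = G (∑ j, h j (x j)))
    (hfpos : ∀ x : Fin n → ℝ, (∀ j, 0 < x j) → 0 < f x)
    (hGdiff : Differentiable ℝ G)
    (hGdiff2 : Differentiable ℝ (deriv G))
    (hGmono : StrictMono G)
    (hG' : ∀ u : ℝ, 0 < deriv G u)
    (hhdiff : ∀ j, ∀ t : ℝ, 0 < t → DifferentiableAt ℝ (h j) t)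
    (hhdiff2 : ∀ j, ∀ t : ℝ, 0 < t → DifferentiableAt ℝ (deriv (h j)) t)
    (hhmono : ∀ j, StrictMonoOn (h j) (Set.Ioi 0) ∨ StrictAntiOn (h j) (Set.Ioi 0))
    (hMRS : ∀ x : Fin n → ℝ, (∀ j, 0 < x j) → ∀ i j : Fin n, i ≠ j →
        pd f j x / pd f i x = x i / x j) :
    (∀ x : Fin n → ℝ, (∀ j, 0 < x j) → ∀ i j : Fin n, i ≠ j →
        x i * deriv (h i) (x i) = x j * deriv (h j) (x j))
    ∧ ∃ k : ℝ, k ≠ 0 ∧ ∀ i : Fin n, ∀ t : ℝ, 0 < t → t * deriv (h i) t = k := by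
  have key : ∀ x : Fin n → ℝ, (∀ j, 0 < x j) → ∀ i j : Fin n, i ≠ j →
      deriv (h i) (x i) ≠ 0 ∧ x i * deriv (h i) (x i) = x j * deriv (h j) (x j) := by
    intro x hx i j hij
    have hr := hMRS x hx i j hij
    rw [pd_quasiSum hf hx i (hGdiff _) (hhdiff i _ (hx i)),
      pd_quasiSum hf hx j (hGdiff _) (hhdiff j _ (hx j)),
      mul_div_mul_left _ _ (hG' _).ne'] at hr
    have hi : deriv (h i) (x i) ≠ 0 := by
      intro h0
      rw [h0, div_zero] at hr
      exact (div_pos (hx i) (hx j)).ne hr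
    refine ⟨hi, ?_⟩
    rw [div_eq_div_iff hi (hx j).ne'] at hr
    linarith
  refine ⟨fun x hx i j hij => (key x hx i j hij).2, ?_⟩
  have hpair : ∀ i j : Fin n, i ≠ j → ∀ s t : ℝ, 0 < s → 0 < t →
      s * deriv (h i) s = t * deriv (h j) t := by
    intro i j hij s t hs ht
    have hx : ∀ l, 0 < Function.update (fun _ : Fin n => t) i s l := by
      intro l
      by_cases hl : l = i
      · subst hl
        simpa using hs
      · simpa [hl] using ht
    simpa [hij.symm] using (key _ hx i j hij).2
  let a : Fin n := ⟨0, by omega⟩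
  let b : Fin n := ⟨1, by omega⟩
  have hab : a ≠ b := by simp [a, b]
  refine ⟨deriv (h a) 1, (key (fun _ => 1) (fun _ => one_pos) a b hab).1, fun i t ht => ?_⟩
  by_cases hi : i = a
  · subst hi
    rw [hpair a b hab t 1 ht one_pos, ← hpair a b hab 1 1 one_pos one_pos, one_mul]
  · rw [hpair i a hi t 1 ht one_pos, one_mul]
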